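/- arXiv:2409.14391 — 7 statements merged into one kernel-verified Lean document; each statement's English description precedes it below -/
import Mathlib

section
/- Let a, b > 0 with a ≠ b and set μ = min(a,b). Then as t → 0⁺, the Dirichlet heat trace of the rectangle [0,a]×[0,b] satisfies ∑_{m≥1}∑_{n≥1} exp(−π²(m²/a² + n²/b²) t) = ab/(4πt) − (a+b)/(4√(πt)) + 1/4 + (ab/(2πt))·e^{−μ²/t} − (μ/(2√(πt)))·e^{−μ²/t} + O(t^{−1} e^{−c/t}), where c = min(max(a,b)², 4·min(a,b)²). -/
open Real Filter Asymptotics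
open scoped Topology

/-- A Gaussian tail sum starting at `k ≥ 1` is summable and dominated by its leading term, uniformly
for `0 < t ≤ 1`. -/
lemma summable_gaussian_tail_and_tsum_le {a t : ℝ} (ha : 0 < a) (ht : 0 < t) (ht1 : t ≤ 1)
    {k : ℕ} (hk : 1 ≤ k) :
    Summable (fun n : ℕ => rexp (-a ^ 2 / t * ((n : ℝ) + k) ^ 2)) ∧
      ∑' n : ℕ, rexp (-a ^ 2 / t * ((n : ℝ) + k) ^ 2)
        ≤ (∑' n : ℕ, rexp (-a ^ 2) ^ n) * rexp (-a ^ 2 * (k : ℝ) ^ 2 / t) := by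
  have hle (n : ℕ) : rexp (-a ^ 2 / t * ((n : ℝ) + k) ^ 2)
      ≤ rexp (-a ^ 2) ^ n * rexp (-a ^ 2 * (k : ℝ) ^ 2 / t) := by
    rw [← Real.exp_nat_mul, ← Real.exp_add, Real.exp_le_exp]
    have hk' : (1 : ℝ) ≤ k := by exact_mod_cast hk
    have hn : (0 : ℝ) ≤ n := n.cast_nonneg
    have hsq : a ^ 2 ≤ a ^ 2 / t := le_div_self (by positivity) ht ht1
    have hnk : (n : ℝ) ≤ n ^ 2 + 2 * n * k := by nlinarith
    have h := mul_le_mul hsq hnk hn (by positivity)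
    have e : -a ^ 2 / t * ((n : ℝ) + k) ^ 2
        = -a ^ 2 * (k : ℝ) ^ 2 / t - a ^ 2 / t * (n ^ 2 + 2 * n * k) := by ring
    rw [e]
    linarith
  have hg : Summable (fun n : ℕ => rexp (-a ^ 2) ^ n) :=
    summable_geometric_of_lt_one (Real.exp_pos _).le
      (Real.exp_lt_one_iff.2 (neg_neg_of_pos (by positivity)))
  have hs := Summable.of_nonneg_of_le (fun n => (Real.exp_pos _).le) hle (hg.mul_right _)
  refine ⟨hs, ?_⟩
  rw [← tsum_mul_right]
  exact hs.tsum_le_tsum hle (hg.mul_right _)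

lemma summable_exp_neg_mul_nat_sq {c : ℝ} (hc : 0 < c) :
    Summable (fun n : ℕ => rexp (-c * (n : ℝ) ^ 2)) := by
  refine Summable.of_nonneg_of_le (fun n => (Real.exp_pos _).le) (fun n => ?_)
    (summable_geometric_of_lt_one (Real.exp_pos (-c)).le (Real.exp_lt_one_iff.2 (neg_neg_of_pos hc)))
  rw [← Real.exp_nat_mul, Real.exp_le_exp]
  have h : (n : ℝ) ≤ (n : ℝ) ^ 2 := by exact_mod_cast Nat.le_self_pow two_ne_zero n
  nlinarith

lemma tsum_int_exp_neg_mul_sq {c : ℝ} (hc : 0 < c) :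
    ∑' n : ℤ, rexp (-c * (n : ℝ) ^ 2) = 1 + 2 * ∑' n : ℕ, rexp (-c * ((n : ℝ) + 1) ^ 2) := by
  have hs := summable_exp_neg_mul_nat_sq hc
  have hs1 : Summable (fun n : ℕ => rexp (-c * ((n : ℝ) + 1) ^ 2)) := by
    simpa using (summable_nat_add_iff 1).2 hs
  have hneg (n : ℕ) : rexp (-c * ((-((n : ℤ) + 1) : ℤ) : ℝ) ^ 2)
      = rexp (-c * ((n : ℝ) + 1) ^ 2) := by
    push_cast
    ring_nf
  rw [tsum_of_nat_of_neg_add_one (by simpa using hs) (by simpa only [hneg] using hs1)]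
  simp only [hneg, Int.cast_natCast]
  rw [hs.tsum_eq_zero_add]
  simp only [Nat.cast_zero, Nat.cast_add, Nat.cast_one, ne_eq, OfNat.ofNat_ne_zero,
    not_false_eq_true, zero_pow, mul_zero, Real.exp_zero]
  ring

/-- The one-dimensional Dirichlet heat trace of `[0, a]`, after Poisson summation. -/
lemma interval_dirichlet_heat_trace_eq {a t : ℝ} (ha : 0 < a) (ht : 0 < t) :
    ∑' n : ℕ, rexp (-(π ^ 2 * t / a ^ 2) * ((n : ℝ) + 1) ^ 2)
      = a * (√(π * t))⁻¹ / 2 - 1 / 2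
        + a * (√(π * t))⁻¹ * ∑' n : ℕ, rexp (-a ^ 2 / t * ((n : ℝ) + 1) ^ 2) := by
  have hA : 0 < π * t / a ^ 2 := by positivity
  have hP := Real.tsum_exp_neg_mul_int_sq hA
  have e1 : -π * (π * t / a ^ 2) = -(π ^ 2 * t / a ^ 2) := by ring
  have e2 : -π / (π * t / a ^ 2) = -(a ^ 2 / t) := by
    field_simp
  have e3 : (π * t / a ^ 2) ^ (1 / 2 : ℝ) = √(π * t) / a := by
    rw [← Real.sqrt_eq_rpow, Real.sqrt_div (by positivity), Real.sqrt_sq ha.le]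
  rw [e1, e2, e3, tsum_int_exp_neg_mul_sq (by positivity), tsum_int_exp_neg_mul_sq (by positivity),
    one_div_div] at hP
  rw [neg_div, ← div_eq_mul_inv]
  linarith

/-- The asymptotics of the product of the heat traces of two intervals, sharp when `a < b`. -/
lemma heat_trace_mul_asymptotics {a b : ℝ} (ha : 0 < a) (hb : 0 < b) :
    (fun t : ℝ =>
      (∑' n : ℕ, rexp (-(π ^ 2 * t / a ^ 2) * ((n : ℝ) + 1) ^ 2)) *
          (∑' n : ℕ, rexp (-(π ^ 2 * t / b ^ 2) * ((n : ℝ) + 1) ^ 2))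
        - (a * b / (4 * π * t) - (a + b) / (4 * √(π * t)) + 1 / 4
            + a * b / (2 * π * t) * rexp (-a ^ 2 / t)
            - a / (2 * √(π * t)) * rexp (-a ^ 2 / t)))
      =O[𝓝[>] (0 : ℝ)]
    (fun t : ℝ => t⁻¹ * rexp (-(min (b ^ 2) (4 * a ^ 2)) / t)) := by
  set Ca := ∑' n : ℕ, rexp (-a ^ 2) ^ n
  set Cb := ∑' n : ℕ, rexp (-b ^ 2) ^ n
  have hCa : 0 ≤ Ca := tsum_nonneg fun n => by positivity
  have hCb : 0 ≤ Cb := tsum_nonneg fun n => by positivity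
  refine IsBigO.of_bound
    ((a * Ca * ((b + 1) / 2) + (a + 1) / 2 * b * Cb + a * b * Ca * Cb) * π⁻¹) ?_
  filter_upwards [Ioo_mem_nhdsGT (show (0 : ℝ) < π⁻¹ by positivity)] with t ⟨ht, htπ⟩
  have ht1 : t ≤ 1 := htπ.le.trans (inv_le_one_of_one_le₀ (by linarith [pi_gt_three]))
  have hπt : 0 < π * t := by positivity
  set u := (√(π * t))⁻¹ with hu
  have hu2 : u ^ 2 = π⁻¹ * t⁻¹ := by
    rw [hu, inv_pow, Real.sq_sqrt hπt.le, mul_inv]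
  have hu1 : 1 ≤ u := by
    refine one_le_inv_iff₀.2 ⟨Real.sqrt_pos.2 hπt, Real.sqrt_le_one.2 ?_⟩
    have := (lt_inv_comm₀ ht pi_pos).1 htπ
    calc π * t ≤ π * π⁻¹ := by gcongr
      _ = 1 := mul_inv_cancel₀ pi_ne_zero
  set G := rexp (-(min (b ^ 2) (4 * a ^ 2)) / t)
  obtain ⟨sa, la⟩ := summable_gaussian_tail_and_tsum_le ha ht ht1 le_rfl
  obtain ⟨-, la2⟩ := summable_gaussian_tail_and_tsum_le ha ht ht1 one_le_two
  obtain ⟨-, lb⟩ := summable_gaussian_tail_and_tsum_le hb ht ht1 le_rfl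
  have hsplit := sa.tsum_eq_zero_add
  simp only [Nat.cast_zero, Nat.cast_one, Nat.cast_add, Nat.cast_ofNat, zero_add, one_pow,
    mul_one, add_assoc, one_add_one_eq_two] at la la2 lb hsplit
  rw [interval_dirichlet_heat_trace_eq ha ht, interval_dirichlet_heat_trace_eq hb ht, ← hu]
  set Ra := ∑' n : ℕ, rexp (-a ^ 2 / t * ((n : ℝ) + 1) ^ 2)
  set Rb := ∑' n : ℕ, rexp (-b ^ 2 / t * ((n : ℝ) + 1) ^ 2)
  set Ta := ∑' n : ℕ, rexp (-a ^ 2 / t * ((n : ℝ) + 2) ^ 2)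
  have hTa : 0 ≤ Ta := tsum_nonneg fun n => (Real.exp_pos _).le
  have hRa : 0 ≤ Ra := tsum_nonneg fun n => (Real.exp_pos _).le
  have hRb : 0 ≤ Rb := tsum_nonneg fun n => (Real.exp_pos _).le
  have hRa' : Ra ≤ Ca := la.trans (mul_le_of_le_one_right hCa (Real.exp_le_one_iff.2
    (div_nonpos_of_nonpos_of_nonneg (by nlinarith) ht.le)))
  have hRb' : Rb ≤ Cb * G := by
    refine lb.trans ?_
    gcongr
    exact Real.exp_le_exp.2 (by gcongr; exact min_le_left _ _)
  have hTa' : Ta ≤ Ca * G := by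
    refine la2.trans ?_
    gcongr
    refine Real.exp_le_exp.2 ?_
    gcongr
    linarith [min_le_right (b ^ 2) (4 * a ^ 2)]
  have hid : (a * u / 2 - 1 / 2 + a * u * Ra) * (b * u / 2 - 1 / 2 + b * u * Rb)
        - (a * b / (4 * π * t) - (a + b) / (4 * √(π * t)) + 1 / 4
            + a * b / (2 * π * t) * rexp (-a ^ 2 / t)
            - a / (2 * √(π * t)) * rexp (-a ^ 2 / t))
      = a * u * Ta * (b * u / 2 - 1 / 2) + (a * u / 2 - 1 / 2) * (b * u * Rb)
        + a * u * Ra * (b * u * Rb) := by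
    have e1 : a * b / (4 * π * t) = a * b / 4 * u ^ 2 := by rw [hu2]; field_simp
    have e2 : a * b / (2 * π * t) = a * b / 2 * u ^ 2 := by rw [hu2]; field_simp
    have e3 : (a + b) / (4 * √(π * t)) = (a + b) / 4 * u := by rw [hu]; field_simp
    have e4 : a / (2 * √(π * t)) = a / 2 * u := by rw [hu]; field_simp
    rw [e1, e2, e3, e4, hsplit]
    ring
  have habs {x : ℝ} (hx : 0 < x) : |x * u / 2 - 1 / 2| ≤ (x + 1) / 2 * u := by
    have := mul_pos hx (zero_lt_one.trans_le hu1)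
    rw [abs_le]
    constructor <;> linarith
  have hu0 : 0 < u := zero_lt_one.trans_le hu1
  have hG : 0 < G := Real.exp_pos _
  rw [hid, Real.norm_eq_abs, Real.norm_of_nonneg (by positivity)]
  calc _ ≤ |a * u * Ta * (b * u / 2 - 1 / 2)| + |(a * u / 2 - 1 / 2) * (b * u * Rb)|
        + |a * u * Ra * (b * u * Rb)| := abs_add_three _ _ _
    _ = a * u * Ta * |b * u / 2 - 1 / 2| + |a * u / 2 - 1 / 2| * (b * u * Rb)
        + a * u * Ra * (b * u * Rb) := by
      rw [abs_mul, abs_mul (a * u / 2 - 1 / 2), abs_of_nonneg (a := a * u * Ta) (by positivity),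
        abs_of_nonneg (a := b * u * Rb) (by positivity),
        abs_of_nonneg (a := a * u * Ra * (b * u * Rb)) (by positivity)]
    _ ≤ a * u * (Ca * G) * ((b + 1) / 2 * u) + (a + 1) / 2 * u * (b * u * (Cb * G))
        + a * u * Ca * (b * u * (Cb * G)) := by
      gcongr
      · exact habs hb
      · exact habs ha
    _ = (a * Ca * ((b + 1) / 2) + (a + 1) / 2 * b * Cb + a * b * Ca * Cb) * u ^ 2 * G := by ring
    _ = _ := by rw [hu2]; ring

lemma tsum_tsum_rectangle_eq_mul (a b t : ℝ) :
    ∑' (m : ℕ) (n : ℕ),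
        rexp (-(π ^ 2 * (((m : ℝ) + 1) ^ 2 / a ^ 2 + ((n : ℝ) + 1) ^ 2 / b ^ 2)) * t)
      = (∑' n : ℕ, rexp (-(π ^ 2 * t / a ^ 2) * ((n : ℝ) + 1) ^ 2)) *
          (∑' n : ℕ, rexp (-(π ^ 2 * t / b ^ 2) * ((n : ℝ) + 1) ^ 2)) := by
  rw [← tsum_mul_right]
  refine tsum_congr fun m => ?_
  rw [← tsum_mul_left]
  refine tsum_congr fun n => ?_
  rw [← Real.exp_add]
  ring_nf

/-- **Sharp short-time asymptotics of the Dirichlet heat trace of a rectangle.**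
For a rectangle `[0,a] × [0,b]` with `a ≠ b`, setting `μ = min a b`, as `t → 0⁺`:
`∑_{m,n ≥ 1} exp(−π²(m²/a² + n²/b²) t)
  = ab/(4πt) − (a+b)/(4√(πt)) + 1/4 + (ab/(2πt))·e^{−μ²/t} − (μ/(2√(πt)))·e^{−μ²/t}
    + O(t⁻¹ e^{−c/t})`,
where `c = min((max a b)², 4 (min a b)²)`. -/
theorem rectangle_dirichlet_heat_trace_asymptotics
    (a b : ℝ) (ha : 0 < a) (hb : 0 < b) (hab : a ≠ b) :
    (fun t : ℝ =>
      (∑' (m : ℕ) (n : ℕ),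
          Real.exp (-(π ^ 2 * (((m : ℝ) + 1) ^ 2 / a ^ 2 + ((n : ℝ) + 1) ^ 2 / b ^ 2)) * t))
        - (a * b / (4 * π * t) - (a + b) / (4 * Real.sqrt (π * t)) + 1 / 4
            + a * b / (2 * π * t) * Real.exp (-(min a b) ^ 2 / t)
            - min a b / (2 * Real.sqrt (π * t)) * Real.exp (-(min a b) ^ 2 / t)))
      =O[𝓝[>] (0 : ℝ)]
    (fun t : ℝ => t⁻¹ * Real.exp (-(min ((max a b) ^ 2) (4 * (min a b) ^ 2)) / t)) := by
  simp only [tsum_tsum_rectangle_eq_mul]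
  rcases hab.lt_or_gt with h | h
  · rw [min_eq_left h.le, max_eq_right h.le]
    exact heat_trace_mul_asymptotics ha hb
  · rw [min_eq_right h.le, max_eq_left h.le]
    refine (heat_trace_mul_asymptotics hb ha).congr_left fun t => ?_
    rw [mul_comm (∑' n : ℕ, rexp (-(π ^ 2 * t / b ^ 2) * ((n : ℝ) + 1) ^ 2)), mul_comm b a,
      add_comm b a]
end

section
/- For integers m, n, let f_{m,n} be the six-term exponential sum f_{m,n}(x,y) = e^{(2πi/3)((m−n)x − (m+n)y/√3)} − e^{(2πi/3)(−mx + (m−2n)y/√3)} + e^{(2πi/3)(−mx + (2n−m)y/√3)} − e^{(2πi/3)(nx + (n−2m)y/√3)} + e^{(2πi/3)(nx + (2m−n)y/√3)} − e^{(2πi/3)((m−n)x + (m+n)y/√3)}. Then f_{m,n}(x, √3(1−x)) = 0 for all x ∈ ℝ if and only if m + n ≡ 0 (mod 3). -/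
open Complex

/-- The six-term exponential sum associated to the equilateral triangle with vertices
`(0,0)`, `(1,0)`, `(1/2, √3/2)`. -/
noncomputable def eqTriFun (m n : ℤ) (x y : ℝ) : ℂ :=
    Complex.exp (2 * Real.pi * Complex.I / 3 *
      (((m : ℂ) - (n : ℂ)) * (x : ℂ) - ((m : ℂ) + (n : ℂ)) * (y : ℂ) / (Real.sqrt 3 : ℂ)))
  - Complex.exp (2 * Real.pi * Complex.I / 3 *
      (-(m : ℂ) * (x : ℂ) + ((m : ℂ) - 2 * (n : ℂ)) * (y : ℂ) / (Real.sqrt 3 : ℂ)))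
  + Complex.exp (2 * Real.pi * Complex.I / 3 *
      (-(m : ℂ) * (x : ℂ) + (2 * (n : ℂ) - (m : ℂ)) * (y : ℂ) / (Real.sqrt 3 : ℂ)))
  - Complex.exp (2 * Real.pi * Complex.I / 3 *
      ((n : ℂ) * (x : ℂ) + ((n : ℂ) - 2 * (m : ℂ)) * (y : ℂ) / (Real.sqrt 3 : ℂ)))
  + Complex.exp (2 * Real.pi * Complex.I / 3 *
      ((n : ℂ) * (x : ℂ) + (2 * (m : ℂ) - (n : ℂ)) * (y : ℂ) / (Real.sqrt 3 : ℂ)))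
  - Complex.exp (2 * Real.pi * Complex.I / 3 *
      (((m : ℂ) - (n : ℂ)) * (x : ℂ) + ((m : ℂ) + (n : ℂ)) * (y : ℂ) / (Real.sqrt 3 : ℂ)))

theorem exp_two_pi_mul_I_div_three_eq_mul {z u w : ℂ} (k : ℤ) (h : w = z + u + 3 * k) :
    exp (2 * Real.pi * I / 3 * w) =
      exp (2 * Real.pi * I / 3 * z) * exp (2 * Real.pi * I / 3 * u) := by
  rw [← exp_add]
  exact exp_eq_exp_iff_exists_int.mpr ⟨k, by rw [h]; ring⟩

/-- On the third side, `f_{m,n}` is a constant times a sum of three exponentials in `x`. -/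
theorem eqTriFun_third_side (m n : ℤ) (x : ℝ) :
    eqTriFun m n x (Real.sqrt 3 * (1 - x)) =
      (exp (2 * Real.pi * I / 3 * -(m + n)) - exp (2 * Real.pi * I / 3 * (m + n))) *
        (exp (2 * Real.pi * I / 3 * (2 * m * x)) + exp (2 * Real.pi * I / 3 * (2 * (n - m) * x))
          + exp (2 * Real.pi * I / 3 * (-2 * n * x))) := by
  have h3 : (Real.sqrt 3 : ℂ) ≠ 0 := by
    rw [ofReal_ne_zero]
    positivity
  have distrib (p q a b c : ℂ) :
      (p - q) * (a + b + c) = p * a - q * b + p * c - q * a + p * b - q * c := by ring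
  rw [distrib, eqTriFun]
  refine congrArg₂ (· - ·) (congrArg₂ (· + ·) (congrArg₂ (· - ·) (congrArg₂ (· + ·)
    (congrArg₂ (· - ·)
      (exp_two_pi_mul_I_div_three_eq_mul 0 ?_) (exp_two_pi_mul_I_div_three_eq_mul (-n) ?_))
      (exp_two_pi_mul_I_div_three_eq_mul n ?_)) (exp_two_pi_mul_I_div_three_eq_mul (-m) ?_))
      (exp_two_pi_mul_I_div_three_eq_mul m ?_)) (exp_two_pi_mul_I_div_three_eq_mul 0 ?_)
  all_goals
    push_cast
    field_simp
    ring

theorem exp_neg_eq_exp_iff_three_dvd (s : ℤ) :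
    exp (2 * Real.pi * I / 3 * -s) = exp (2 * Real.pi * I / 3 * s) ↔ (3 : ℤ) ∣ s := by
  rw [exp_eq_exp_iff_exists_int]
  have hpi : 2 * Real.pi * I ≠ 0 := two_pi_I_ne_zero
  have key (k : ℤ) : 2 * Real.pi * I / 3 * -(s : ℂ) =
      2 * Real.pi * I / 3 * s + k * (2 * Real.pi * I) ↔ -(2 * s) = 3 * k := by
    rw [← Int.cast_inj (α := ℂ)]
    push_cast
    constructor <;> intro h
    · apply mul_left_cancel₀ hpi
      linear_combination 3 * h
    · linear_combination (2 * Real.pi * I / 3) * h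
  simp only [key]
  constructor
  · rintro ⟨k, hk⟩
    lia
  · rintro ⟨k, rfl⟩
    exact ⟨-2 * k, by ring⟩

/-- **Vanishing on the third side characterizes the mod-3 condition:**
`f_{m,n}(x, √3(1−x)) = 0` for all real `x` if and only if `3 ∣ m + n`. -/
theorem eqTriFun_vanishes_on_third_side_iff (m n : ℤ) :
    (∀ x : ℝ, eqTriFun m n x (Real.sqrt 3 * (1 - x)) = 0) ↔ (3 : ℤ) ∣ (m + n) := by
  have factor := eqTriFun_third_side m n
  have hs := exp_neg_eq_exp_iff_three_dvd (m + n)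
  push_cast at hs
  rw [← hs, ← sub_eq_zero]
  constructor
  · intro h
    have h0 := (factor 0).symm.trans (h 0)
    refine (mul_eq_zero.mp h0).resolve_right ?_
    norm_num
  · intro h x
    rw [factor, h, zero_mul]
end

section
/- For integers m, n satisfying: m + n ≡ 0 (mod 3), m ≠ 2n, n ≠ 2m, and m ≠ −n, the six-term exponential sum f_{m,n}(x,y) = e^{(2πi/3)((m−n)x − (m+n)y/√3)} − e^{(2πi/3)(−mx + (m−2n)y/√3)} + e^{(2πi/3)(−mx + (2n−m)y/√3)} − e^{(2πi/3)(nx + (n−2m)y/√3)} + e^{(2πi/3)(nx + (2m−n)y/√3)} − e^{(2πi/3)((m−n)x + (m+n)y/√3)} is not identically zero on ℝ². -/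
open Complex

/-- Distinct integer multiples of the irrational frequency `√2` give distinct values of
`t ↦ exp (2πit/3)`. -/
theorem exp_two_pi_I_div_three_mul_sqrt_two_injective {p q : ℤ}
    (h : Complex.exp (2 * Real.pi * Complex.I / 3 * ((p : ℂ) * (Real.sqrt 2 : ℂ))) =
      Complex.exp (2 * Real.pi * Complex.I / 3 * ((q : ℂ) * (Real.sqrt 2 : ℂ)))) : p = q := by
  obtain ⟨k, hk⟩ := Complex.exp_eq_exp_iff_exists_int.mp h
  have hpi : (2 * Real.pi * Complex.I : ℂ) ≠ 0 := Complex.two_pi_I_ne_zero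
  have hc : ((p : ℂ) - q) * (Real.sqrt 2 : ℂ) = 3 * k :=
    mul_left_cancel₀ hpi (by linear_combination 3 * hk)
  have hr : (((p - q : ℤ) : ℝ)) * Real.sqrt 2 = ((3 * k : ℤ) : ℝ) := by
    apply Complex.ofReal_injective
    push_cast
    exact hc
  by_contra hpq
  exact (irrational_sqrt_two.intCast_mul (sub_ne_zero.mpr hpq)).ne_int _ hr

/-- A combination of the powers of three scalars, the first distinct from the other two, that
vanishes for the exponents `0`, `1`, `2` has zero first coefficient. -/
theorem eq_zero_of_three_power_sums_eq_zero {K : Type*} [Field K] {u v w A B C : K}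
    (huv : u ≠ v) (huw : u ≠ w) (h₀ : A + B + C = 0) (h₁ : A * u + B * v + C * w = 0)
    (h₂ : A * u ^ 2 + B * v ^ 2 + C * w ^ 2 = 0) : A = 0 := by
  have h : A * ((u - v) * (u - w)) = 0 := by
    linear_combination h₂ - (v + w) * h₁ + v * w * h₀
  exact (mul_eq_zero.mp h).resolve_right
    (mul_ne_zero (sub_ne_zero.mpr huv) (sub_ne_zero.mpr huw))

/-- Values of `eqTriFun` at the points `(j√2, √3√2)`, grouped by frequency in `x`. -/
theorem eqTriFun_nat_mul_sqrt_two (m n : ℤ) (j : ℕ) (e : ℤ → ℂ)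
    (he : ∀ k : ℤ, e k =
      Complex.exp (2 * Real.pi * Complex.I / 3 * ((k : ℂ) * (Real.sqrt 2 : ℂ)))) :
    eqTriFun m n (j * Real.sqrt 2) (Real.sqrt 3 * Real.sqrt 2) =
      (e (-(m + n)) - e (m + n)) * e (m - n) ^ j +
      (e (2 * n - m) - e (m - 2 * n)) * e (-m) ^ j +
      (e (2 * m - n) - e (n - 2 * m)) * e n ^ j := by
  have h3 : (Real.sqrt 3 : ℂ) ≠ 0 := by
    exact_mod_cast (Real.sqrt_pos.mpr (by norm_num : (0 : ℝ) < 3)).ne'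
  have hdiv (t : ℂ) :
      t * ((Real.sqrt 3 : ℂ) * (Real.sqrt 2 : ℂ)) / (Real.sqrt 3 : ℂ) =
        t * (Real.sqrt 2 : ℂ) := by
    field_simp
  simp only [eqTriFun, he, ← Complex.exp_nat_mul, sub_mul (Complex.exp _), ← Complex.exp_add]
  push_cast
  simp only [hdiv]
  ring_nf

/-- **Nondegeneracy:** if `3 ∣ m + n`, `m ≠ 2n`, `n ≠ 2m` and `m ≠ −n`, then the six-term
exponential sum `f_{m,n}` is not identically zero on `ℝ²`. -/
theorem eqTriFun_admissible_ne_zero (m n : ℤ)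
    (hA : (3 : ℤ) ∣ (m + n)) (hB : m ≠ 2 * n) (hC : n ≠ 2 * m) (hD : m ≠ -n) :
    ∃ x y : ℝ, eqTriFun m n x y ≠ 0 := by
  by_contra! hzero
  let e : ℤ → ℂ := fun k =>
    Complex.exp (2 * Real.pi * Complex.I / 3 * ((k : ℂ) * (Real.sqrt 2 : ℂ)))
  have hinj : Function.Injective e := fun _ _ h =>
    exp_two_pi_I_div_three_mul_sqrt_two_injective h
  have hval (j : ℕ) := (eqTriFun_nat_mul_sqrt_two m n j e fun _ => rfl).symm.trans (hzero _ _)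
  have hcoeff : e (-(m + n)) - e (m + n) = 0 :=
    eq_zero_of_three_power_sums_eq_zero (u := e (m - n)) (v := e (-m)) (w := e n)
      (hinj.ne (by omega)) (hinj.ne (by omega))
      (by simpa using hval 0) (by simpa using hval 1) (hval 2)
  have hsum := hinj (sub_eq_zero.mp hcoeff)
  omega
end

section
/- For every real q with 0 < q < 1, ∑_{m∈ℤ}∑_{n∈ℤ} q^{m² − mn + n²} = Θ₃(q)·Θ₃(q³) + Θ₂(q)·Θ₂(q³), where Θ₃(q) = ∑_{n∈ℤ} q^{n²} and Θ₂(q) = ∑_{n∈ℤ} q^{(n+1/2)²}. -/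
open Real

/-- The Jacobi theta function `Θ₃(q) = ∑_{n ∈ ℤ} q^{n²}`. -/
noncomputable def theta3 (q : ℝ) : ℝ := ∑' n : ℤ, q ^ (n ^ 2)

/-- The Jacobi theta function `Θ₂(q) = ∑_{n ∈ ℤ} q^{(n+1/2)²}` (real exponents via `rpow`). -/
noncomputable def theta2 (q : ℝ) : ℝ := ∑' n : ℤ, q ^ (((n : ℝ) + 1 / 2) ^ 2)

lemma summable_rpow_int_add_sq {q : ℝ} (hq0 : 0 < q) (hq1 : q < 1) (a : ℝ) :
    Summable fun n : ℤ => q ^ (((n : ℝ) + a) ^ 2) := by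
  have hgeo : Summable fun n : ℤ => q ^ |(n : ℝ)| := by
    have h := summable_geometric_of_lt_one hq0.le hq1
    apply Summable.of_nat_of_neg <;> simpa using h
  refine Summable.of_nonneg_of_le (fun n => (rpow_pos_of_pos hq0 _).le) (fun n => ?_)
    (hgeo.mul_left (q ^ (-|a| - 1 / 4)))
  rw [← rpow_add hq0]
  refine rpow_le_rpow_of_exponent_ge hq0 hq1.le ?_
  have h := abs_sub_abs_le_abs_sub (n : ℝ) (-a)
  rw [abs_neg, sub_neg_eq_add] at h
  nlinarith [sq_nonneg (|(n : ℝ) + a| - 1 / 2), sq_abs ((n : ℝ) + a)]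

/-- The partition of `ℤ × ℤ` by the parity of the second coordinate, in the coordinates
diagonalizing `m² - mn + n²`. -/
noncomputable def parityEquiv : (ℤ × ℤ) ⊕ (ℤ × ℤ) ≃ ℤ × ℤ :=
  Equiv.ofBijective
    (Sum.elim (fun p => (p.1 + p.2, 2 * p.2)) (fun p => (p.1 + p.2 + 1, 2 * p.2 + 1))) <| by
    constructor
    · rintro (⟨a, b⟩ | ⟨a, b⟩) (⟨c, d⟩ | ⟨c, d⟩) h <;>
        simp only [Sum.elim_inl, Sum.elim_inr, Prod.mk.injEq, Sum.inl.injEq, Sum.inr.injEq,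
          reduceCtorEq] at h ⊢ <;> omega
    · rintro ⟨m, n⟩
      obtain ⟨k, rfl | rfl⟩ := Int.even_or_odd' n
      · exact ⟨.inl (m - k, k), by simp⟩
      · exact ⟨.inr (m - k - 1, k), by simp; ring⟩

lemma parityEquiv_inl (p : ℤ × ℤ) : parityEquiv (.inl p) = (p.1 + p.2, 2 * p.2) := rfl

lemma parityEquiv_inr (p : ℤ × ℤ) :
    parityEquiv (.inr p) = (p.1 + p.2 + 1, 2 * p.2 + 1) := rfl

lemma hasSum_int_sq_mul_int_sq {q : ℝ} (hq0 : 0 < q) (hq1 : q < 1) (a : ℝ) :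
    HasSum (fun p : ℤ × ℤ => q ^ (((p.1 : ℝ) + a) ^ 2 + 3 * ((p.2 : ℝ) + a) ^ 2))
      ((∑' n : ℤ, q ^ (((n : ℝ) + a) ^ 2)) * ∑' n : ℤ, (q ^ 3) ^ (((n : ℝ) + a) ^ 2)) := by
  have h1 := summable_rpow_int_add_sq hq0 hq1 a
  have h2 := summable_rpow_int_add_sq (pow_pos hq0 3) (pow_lt_one₀ hq0.le hq1 three_ne_zero) a
  have h := h1.hasSum.mul h2.hasSum (h1.mul_of_nonneg h2
    (fun n => (rpow_pos_of_pos hq0 _).le) fun n => (rpow_pos_of_pos (pow_pos hq0 3) _).le)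
  convert! h using 2 with p
  rw [rpow_add hq0, rpow_mul hq0.le]
  norm_cast

lemma theta3_eq_tsum_rpow (q : ℝ) : theta3 q = ∑' n : ℤ, q ^ (((n : ℝ) + 0) ^ 2) := by
  refine tsum_congr fun n => ?_
  rw [add_zero, ← rpow_intCast, Int.cast_pow]

/-- **Theta-function identity for the quadratic form `m² − mn + n²`:**
for `0 < q < 1`, `∑_{m,n ∈ ℤ} q^{m² − mn + n²} = Θ₃(q)Θ₃(q³) + Θ₂(q)Θ₂(q³)`. -/
theorem tsum_int_pow_sub_quadratic_form (q : ℝ) (hq0 : 0 < q) (hq1 : q < 1) :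
    ∑' p : ℤ × ℤ, q ^ (p.1 ^ 2 - p.1 * p.2 + p.2 ^ 2)
      = theta3 q * theta3 (q ^ 3) + theta2 q * theta2 (q ^ 3) := by
  rw [theta3_eq_tsum_rpow, theta3_eq_tsum_rpow, theta2, theta2, ← parityEquiv.tsum_eq]
  refine (HasSum.sum ?_ ?_).tsum_eq
  · convert! hasSum_int_sq_mul_int_sq hq0 hq1 0 using 2 with p
    rw [Function.comp_apply, parityEquiv_inl, ← rpow_intCast]
    congr 1
    push_cast
    ring
  · convert! hasSum_int_sq_mul_int_sq hq0 hq1 (1 / 2) using 2 with p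
    rw [Function.comp_apply, parityEquiv_inr, ← rpow_intCast]
    congr 1
    push_cast
    ring
end

section
/- For every real q with 0 < q < 1, ∑_{m=1}^∞ ∑_{n=1}^∞ q^{3(m² + mn + n²)} = (Θ₃(q³)·Θ₃(q⁹) + Θ₂(q³)·Θ₂(q⁹) − 3·Θ₃(q³) + 2)/6, where Θ₃(q) = ∑_{n∈ℤ} q^{n²} and Θ₂(q) = ∑_{n∈ℤ} q^{(n+1/2)²}. Consequently, the two expressions in the literature for the Dirichlet heat trace of the equilateral triangle of side length ℓ — (1/6)∑ over pairs (m,n)∈ℤ² with m+n ≡ 0 (mod 3), m ≠ 2n, n ≠ 2m, m ≠ −n of exp(−(16π²/(27ℓ²))(m²−mn+n²)t), and ∑_{m,n≥1} exp(−(16π²/(9ℓ²))(m²+mn+n²)t) — are equal for all t > 0. -/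
open Real

/-- The quadratic form `a² + ab + b²`, the norm form of the hexagonal lattice. -/
def hexNorm (p : ℤ × ℤ) : ℤ := p.1 ^ 2 + p.1 * p.2 + p.2 ^ 2

/-- Rotation of the hexagonal lattice by a sixth of a turn. -/
def hexRotation : ℤ × ℤ ≃ ℤ × ℤ where
  toFun p := (-p.2, p.1 + p.2)
  invFun p := (p.1 + p.2, -p.1)
  left_inv p := by ext <;> simp
  right_inv p := by ext <;> simp

theorem hexNorm_hexRotation (p : ℤ × ℤ) : hexNorm (hexRotation p) = hexNorm p := by
  simp only [hexNorm, hexRotation, Equiv.coe_fn_mk]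
  ring

theorem summable_rpow_of_abs_sub_one_le {x : ℝ} (hx0 : 0 < x) (hx1 : x < 1) {e : ℤ → ℝ}
    (he : ∀ n : ℤ, |(n : ℝ)| - 1 ≤ e n) : Summable fun n : ℤ => x ^ e n := by
  have hnat : Summable fun n : ℕ => x ^ n * x⁻¹ :=
    (summable_geometric_of_lt_one hx0.le hx1).mul_right _
  have hbound : ∀ n : ℤ, x ^ e n ≤ x ^ n.natAbs * x⁻¹ := fun n => by
    have h := rpow_le_rpow_of_exponent_ge hx0 hx1.le (he n)
    rwa [rpow_sub_one hx0.ne', ← Int.cast_abs, Int.abs_eq_natAbs, Int.cast_natCast,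
      rpow_natCast, div_eq_mul_inv] at h
  refine Summable.of_nonneg_of_le (fun n => rpow_nonneg hx0.le _) hbound ?_
  exact Summable.of_nat_of_neg (by simpa using hnat) (by simpa using hnat)

theorem summable_zpow_sq {x : ℝ} (hx0 : 0 < x) (hx1 : x < 1) :
    Summable fun n : ℤ => x ^ (n ^ 2) := by
  have h : Summable fun n : ℤ => x ^ ((n : ℝ) ^ 2) :=
    summable_rpow_of_abs_sub_one_le hx0 hx1 fun n => by
      nlinarith [sq_nonneg (|(n : ℝ)| - 1), sq_abs (n : ℝ)]
  exact h.congr fun n => by rw [← rpow_intCast]; push_cast; rfl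

theorem summable_rpow_add_half_sq {x : ℝ} (hx0 : 0 < x) (hx1 : x < 1) :
    Summable fun n : ℤ => x ^ (((n : ℝ) + 1 / 2) ^ 2) :=
  summable_rpow_of_abs_sub_one_le hx0 hx1 fun n => by
    rcases abs_cases (n : ℝ) with ⟨h, _⟩ | ⟨h, _⟩ <;> rw [h]
    · nlinarith [sq_nonneg (n : ℝ)]
    · nlinarith [sq_nonneg ((n : ℝ) + 1)]

theorem summable_zpow_hexNorm {x : ℝ} (hx0 : 0 < x) (hx1 : x < 1) :
    Summable fun p : ℤ × ℤ => x ^ hexNorm p := by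
  have hs0 : 0 < √x := Real.sqrt_pos.2 hx0
  have hs1 : √x < 1 := by rw [Real.sqrt_lt' one_pos]; simpa using hx1
  have hs := summable_zpow_sq hs0 hs1
  refine Summable.of_nonneg_of_le (fun p => (zpow_pos hx0 _).le) (fun p => ?_)
    (hs.mul_of_nonneg hs (fun n => (zpow_pos hs0 _).le) fun n => (zpow_pos hs0 _).le)
  rw [← zpow_add₀ hs0.ne']
  calc x ^ hexNorm p = √x ^ (2 * hexNorm p) := by
        rw [zpow_mul, zpow_ofNat, Real.sq_sqrt hx0.le]
    _ ≤ √x ^ (p.1 ^ 2 + p.2 ^ 2) := by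
        refine zpow_le_zpow_right_of_le_one₀ hs0 hs1.le ?_
        unfold hexNorm
        nlinarith [sq_nonneg (p.1 + p.2)]

/-- The lattice points off the three reflection lines of the hexagonal lattice. -/
def hexRegular : Set (ℤ × ℤ) := {p | p.1 ≠ 0 ∧ p.2 ≠ 0 ∧ p.1 + p.2 ≠ 0}

theorem HasSum.comp_hexRotation {g : ℤ × ℤ → ℝ} {s : ℝ} (h : HasSum g s) :
    HasSum (fun p => g (hexRotation p)) s :=
  hexRotation.hasSum_iff.2 h

/-- The open sector of the hexagonal lattice spanned by the two basis vectors. -/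
def hexSector : Set (ℤ × ℤ) := {p | 0 < p.1 ∧ 0 < p.2}

theorem tsum_hexSector {f : ℤ × ℤ → ℝ} (hf : Summable f) :
    ∑' p, hexSector.indicator f p = ∑' (m : ℕ) (n : ℕ), f ((m : ℤ) + 1, (n : ℤ) + 1) := by
  have hinj : Function.Injective fun p : ℕ × ℕ => ((p.1 : ℤ) + 1, (p.2 : ℤ) + 1) := by
    rintro ⟨a, b⟩ ⟨c, d⟩ h
    simp only [Prod.mk.injEq] at h ⊢
    omega
  have hsupp : (hexSector.indicator f).support
      ⊆ Set.range fun p : ℕ × ℕ => ((p.1 : ℤ) + 1, (p.2 : ℤ) + 1) := by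
    rintro ⟨a, b⟩ h
    have hab : (a, b) ∈ hexSector := Set.support_indicator_subset h
    simp only [hexSector, Set.mem_ofPred_eq] at hab
    exact ⟨((a - 1).toNat, (b - 1).toNat), by ext <;> simp <;> omega⟩
  rw [← hinj.tsum_eq hsupp]
  refine Eq.trans ?_ (hf.comp_injective hinj).tsum_prod
  refine tsum_congr fun p => Set.indicator_of_mem ?_ f
  simp only [hexSector, Set.mem_ofPred_eq]
  omega

theorem hexSector_indicator (f : ℤ × ℤ → ℝ) (a b : ℤ) :
    hexSector.indicator f (a, b) = if 0 < a ∧ 0 < b then f (a, b) else 0 := by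
  split_ifs with h
  · exact Set.indicator_of_mem (s := hexSector) (a := (a, b)) h f
  · exact Set.indicator_of_notMem (s := hexSector) (a := (a, b)) h f

theorem hexRegular_indicator (f : ℤ × ℤ → ℝ) (a b : ℤ) :
    hexRegular.indicator f (a, b) = if a ≠ 0 ∧ b ≠ 0 ∧ a + b ≠ 0 then f (a, b) else 0 := by
  split_ifs with h
  · exact Set.indicator_of_mem (s := hexRegular) (a := (a, b)) h f
  · exact Set.indicator_of_notMem (s := hexRegular) (a := (a, b)) h f

theorem hexRegular_indicator_eq (F : ℤ → ℝ) (p : ℤ × ℤ) :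
    hexRegular.indicator (fun p => F (hexNorm p)) p =
      let g := hexSector.indicator fun p => F (hexNorm p)
      let R := hexRotation
      g p + g (R p) + g (R (R p)) + g (R (R (R p))) + g (R (R (R (R p))))
        + g (R (R (R (R (R p))))) := by
  obtain ⟨a, b⟩ := p
  have h1 : hexNorm (-b, a + b) = hexNorm (a, b) := hexNorm_hexRotation (a, b)
  have h2 := hexNorm_hexRotation (-b, a + b)
  have h3 := hexNorm_hexRotation (hexRotation (-b, a + b))
  have h4 := hexNorm_hexRotation (hexRotation (hexRotation (-b, a + b)))
  have h5 := hexNorm_hexRotation (hexRotation (hexRotation (hexRotation (-b, a + b))))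
  simp only [hexRotation, Equiv.coe_fn_mk] at h2 h3 h4 h5 ⊢
  simp only [hexSector_indicator, hexRegular_indicator, h1, h2, h3, h4, h5]
  generalize F (hexNorm (a, b)) = v
  split_ifs <;> first | (exfalso; omega) | ring

theorem tsum_sixfold {F : ℤ → ℝ} (hF : Summable fun p => F (hexNorm p)) :
    ∑' p, hexRegular.indicator (fun p => F (hexNorm p)) p
      = 6 * ∑' (m : ℕ) (n : ℕ), F (hexNorm ((m : ℤ) + 1, (n : ℤ) + 1)) := by
  rw [← tsum_hexSector hF, tsum_congr (hexRegular_indicator_eq F)]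
  have h0 := (hF.indicator hexSector).hasSum
  have h1 := h0.comp_hexRotation
  have h2 := h1.comp_hexRotation
  have h3 := h2.comp_hexRotation
  have h4 := h3.comp_hexRotation
  have h5 := h4.comp_hexRotation
  refine (((((h0.add h1).add h2).add h3).add h4).add h5).tsum_eq.trans ?_
  ring

/-- The first coordinate axis of the hexagonal lattice. -/
def hexAxis : Set (ℤ × ℤ) := {p | p.2 = 0}

theorem hexAxis_indicator (f : ℤ × ℤ → ℝ) (a b : ℤ) :
    hexAxis.indicator f (a, b) = if (a, b).2 = 0 then f (a, b) else 0 := by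
  split_ifs with h
  · exact Set.indicator_of_mem (s := hexAxis) (a := (a, b)) h f
  · exact Set.indicator_of_notMem (s := hexAxis) (a := (a, b)) h f

theorem tsum_hexAxis (F : ℤ → ℝ) :
    ∑' p, hexAxis.indicator (fun p => F (hexNorm p)) p = ∑' n : ℤ, F (n ^ 2) := by
  have hinj : Function.Injective fun n : ℤ => (n, (0 : ℤ)) := fun a b h => by simpa using h
  rw [← hinj.tsum_eq]
  · exact tsum_congr fun n => by simp [hexAxis, hexNorm]
  · rintro ⟨a, b⟩ h
    have hb : (a, b) ∈ hexAxis := Set.support_indicator_subset h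
    simp only [hexAxis, Set.mem_ofPred_eq] at hb
    exact ⟨a, by rw [hb]⟩

theorem hexNorm_apply_eq (F : ℤ → ℝ) (p : ℤ × ℤ) :
    F (hexNorm p) =
      let g := hexAxis.indicator fun p => F (hexNorm p)
      let R := hexRotation
      hexRegular.indicator (fun p => F (hexNorm p)) p + g p + g (R p) + g (R (R p))
        - (if p = 0 then 2 * F 0 else 0) := by
  obtain ⟨a, b⟩ := p
  by_cases h : ((a, b) : ℤ × ℤ) = 0
  · obtain ⟨rfl, rfl⟩ := Prod.mk.inj h
    simp [hexAxis, hexRegular, hexRotation, hexNorm]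
    ring
  · have h1 : hexNorm (-b, a + b) = hexNorm (a, b) := hexNorm_hexRotation (a, b)
    have h2 := hexNorm_hexRotation (-b, a + b)
    simp only [hexRotation, Equiv.coe_fn_mk] at h2 ⊢
    rw [if_neg h]
    simp only [hexAxis_indicator, hexRegular_indicator, h1, h2]
    rw [Prod.mk_eq_zero] at h
    generalize F (hexNorm (a, b)) = v
    split_ifs <;> first | (exfalso; omega) | ring

theorem tsum_hexNorm_eq {F : ℤ → ℝ} (hF : Summable fun p => F (hexNorm p)) :
    ∑' p, F (hexNorm p) = ∑' p, hexRegular.indicator (fun p => F (hexNorm p)) p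
      + 3 * ∑' n : ℤ, F (n ^ 2) - 2 * F 0 := by
  rw [← tsum_hexAxis F, tsum_congr (hexNorm_apply_eq F)]
  have hd := (hF.indicator hexRegular).hasSum
  have h0 := (hF.indicator hexAxis).hasSum
  have h1 := h0.comp_hexRotation
  have h2 := h1.comp_hexRotation
  refine ((((hd.add h0).add h1).add h2).sub (hasSum_ite_eq 0 (2 * F 0))).tsum_eq.trans ?_
  ring

theorem tsum_hexNorm_parity {F : ℤ → ℝ} (hF : Summable fun p => F (hexNorm p)) :
    ∑' p, F (hexNorm p) = ∑' p : ℤ × ℤ, F (p.1 ^ 2 + 3 * p.2 ^ 2)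
      + ∑' p : ℤ × ℤ, F (p.1 ^ 2 + p.1 + 3 * (p.2 ^ 2 + p.2) + 1) := by
  have key : ∀ c : ℤ, ∑' p, {p : ℤ × ℤ | p.2 % 2 = c % 2}.indicator (fun p => F (hexNorm p)) p
      = ∑' p : ℤ × ℤ, F (hexNorm (p.1 - p.2, 2 * p.2 + c)) := fun c => by
    have hinj : Function.Injective fun p : ℤ × ℤ => (p.1 - p.2, 2 * p.2 + c) := by
      rintro ⟨a, b⟩ ⟨a', b'⟩ h
      simp only [Prod.mk.injEq] at h ⊢
      omega
    rw [← hinj.tsum_eq]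
    · exact tsum_congr fun p => Set.indicator_of_mem (by simp) _
    · rintro ⟨a, b⟩ h
      have hb : (a, b) ∈ {p : ℤ × ℤ | p.2 % 2 = c % 2} := Set.support_indicator_subset h
      simp only [Set.mem_ofPred_eq] at hb
      exact ⟨(a + (b - c) / 2, (b - c) / 2), by ext <;> dsimp <;> omega⟩
  have hsplit : ∀ p, F (hexNorm p)
      = {p : ℤ × ℤ | p.2 % 2 = 0 % 2}.indicator (fun p => F (hexNorm p)) p
        + {p : ℤ × ℤ | p.2 % 2 = 1 % 2}.indicator (fun p => F (hexNorm p)) p := by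
    classical
    intro p
    simp only [Set.indicator_apply, Set.mem_ofPred_eq]
    split_ifs <;> first | (exfalso; omega) | simp
  refine (tsum_congr hsplit).trans ?_
  rw [Summable.tsum_add (hF.indicator _) (hF.indicator _), key 0, key 1]
  congr 1 <;> refine tsum_congr fun p => congrArg F ?_ <;> simp only [hexNorm] <;> ring

theorem tsum_mul_tsum_of_nonneg {f g : ℤ → ℝ} (hf : Summable f) (hg : Summable g)
    (hf0 : ∀ n, 0 ≤ f n) (hg0 : ∀ n, 0 ≤ g n) :
    (∑' n, f n) * ∑' n, g n = ∑' p : ℤ × ℤ, f p.1 * g p.2 :=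
  hf.tsum_mul_tsum hg (hf.mul_of_nonneg hg hf0 hg0)

theorem tsum_zpow_hexNorm {x : ℝ} (hx0 : 0 < x) (hx1 : x < 1) :
    ∑' p, x ^ hexNorm p = theta3 x * theta3 (x ^ 3) + theta2 x * theta2 (x ^ 3) := by
  have hy0 : 0 < x ^ 3 := pow_pos hx0 3
  have hy1 : x ^ 3 < 1 := pow_lt_one₀ hx0.le hx1 (by norm_num)
  have h3 : theta3 x * theta3 (x ^ 3) = ∑' p : ℤ × ℤ, x ^ (p.1 ^ 2 + 3 * p.2 ^ 2) := by
    rw [theta3, theta3, tsum_mul_tsum_of_nonneg (summable_zpow_sq hx0 hx1)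
      (summable_zpow_sq hy0 hy1) (fun n => (zpow_pos hx0 _).le) fun n => (zpow_pos hy0 _).le]
    refine tsum_congr fun p => ?_
    rw [zpow_add₀ hx0.ne', zpow_mul, zpow_ofNat]
  have h2 : theta2 x * theta2 (x ^ 3)
      = ∑' p : ℤ × ℤ, x ^ (p.1 ^ 2 + p.1 + 3 * (p.2 ^ 2 + p.2) + 1) := by
    rw [theta2, theta2, tsum_mul_tsum_of_nonneg (summable_rpow_add_half_sq hx0 hx1)
      (summable_rpow_add_half_sq hy0 hy1) (fun n => Real.rpow_nonneg hx0.le _)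
      fun n => Real.rpow_nonneg hy0.le _]
    refine tsum_congr fun p => ?_
    have hp : (x ^ 3) ^ (((p.2 : ℝ) + 1 / 2) ^ 2) = x ^ (3 * ((p.2 : ℝ) + 1 / 2) ^ 2) := by
      rw [Real.rpow_mul hx0.le, Real.rpow_ofNat]
    rw [hp, ← Real.rpow_add hx0, ← Real.rpow_intCast]
    congr 1
    push_cast
    ring
  rw [h3, h2, tsum_hexNorm_parity (F := fun k => x ^ k) (summable_zpow_hexNorm hx0 hx1)]

/-- The parametrization `(a, b) ↦ (2a + b, a - b)` of the pairs `(m, n)` with `3 ∣ m + n`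
turns `m² - mn + n²` into `3 (a² + ab + b²)`. -/
theorem tsum_subtype_eq_tsum_hexRegular (G : ℤ → ℝ) :
    ∑' p : {p : ℤ × ℤ // (3 : ℤ) ∣ (p.1 + p.2) ∧ p.1 ≠ 2 * p.2 ∧ p.2 ≠ 2 * p.1 ∧ p.1 ≠ -p.2},
        G (p.1.1 ^ 2 - p.1.1 * p.1.2 + p.1.2 ^ 2)
      = ∑' p, hexRegular.indicator (fun p => G (3 * hexNorm p)) p := by
  classical
  have hinj : Function.Injective fun p : ℤ × ℤ => (2 * p.1 + p.2, p.1 - p.2) := by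
    rintro ⟨a, b⟩ ⟨a', b'⟩ h
    simp only [Prod.mk.injEq] at h ⊢
    omega
  refine (tsum_subtype {p : ℤ × ℤ | (3 : ℤ) ∣ (p.1 + p.2) ∧ p.1 ≠ 2 * p.2 ∧ p.2 ≠ 2 * p.1
    ∧ p.1 ≠ -p.2} fun p => G (p.1 ^ 2 - p.1 * p.2 + p.2 ^ 2)).trans ?_
  rw [← hinj.tsum_eq]
  · refine tsum_congr fun ⟨a, b⟩ => ?_
    simp only [Set.indicator_apply, hexRegular, Set.mem_ofPred_eq]
    refine if_congr (by omega) (congrArg G ?_) rfl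
    simp only [hexNorm]
    ring
  · rintro ⟨a, b⟩ h
    have hab := (Set.support_indicator_subset h).1
    dsimp only at hab
    exact ⟨((a + b) / 3, (a + b) / 3 - b), by ext <;> dsimp <;> omega⟩

/-- **Equivalence of the two expressions for the Dirichlet heat trace of the equilateral
triangle.** For `0 < q < 1`,
`∑_{m,n ≥ 1} q^{3(m² + mn + n²)} = (Θ₃(q³)Θ₃(q⁹) + Θ₂(q³)Θ₂(q⁹) − 3Θ₃(q³) + 2)/6`;
consequently, for every side length `ℓ > 0` and time `t > 0`, the sum
`(1/6) ∑ exp(−(16π²/(27ℓ²))(m²−mn+n²)t)` over pairs `(m,n) ∈ ℤ²` with `3 ∣ m+n`, `m ≠ 2n`,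
`n ≠ 2m`, `m ≠ −n` equals `∑_{m,n ≥ 1} exp(−(16π²/(9ℓ²))(m²+mn+n²)t)`. -/
theorem equilateral_heat_trace_two_expressions
    (q : ℝ) (hq0 : 0 < q) (hq1 : q < 1) (ℓ t : ℝ) (hℓ : 0 < ℓ) (ht : 0 < t) :
    (∑' (m : ℕ) (n : ℕ),
        q ^ (3 * (((m : ℕ) + 1) ^ 2 + ((m : ℕ) + 1) * ((n : ℕ) + 1) + ((n : ℕ) + 1) ^ 2))
      = (theta3 (q ^ 3) * theta3 (q ^ 9) + theta2 (q ^ 3) * theta2 (q ^ 9)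
          - 3 * theta3 (q ^ 3) + 2) / 6)
    ∧ (1 / 6) * (∑' p : {p : ℤ × ℤ // (3 : ℤ) ∣ (p.1 + p.2) ∧ p.1 ≠ 2 * p.2
            ∧ p.2 ≠ 2 * p.1 ∧ p.1 ≠ -p.2},
          Real.exp (-(16 * π ^ 2 / (27 * ℓ ^ 2))
            * ((p.1.1 : ℝ) ^ 2 - (p.1.1 : ℝ) * (p.1.2 : ℝ) + (p.1.2 : ℝ) ^ 2) * t))
      = ∑' (m : ℕ) (n : ℕ),
          Real.exp (-(16 * π ^ 2 / (9 * ℓ ^ 2))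
            * (((m : ℝ) + 1) ^ 2 + ((m : ℝ) + 1) * ((n : ℝ) + 1) + ((n : ℝ) + 1) ^ 2) * t) := by
  constructor
  · have hx0 : 0 < q ^ 3 := pow_pos hq0 3
    have hx1 : q ^ 3 < 1 := pow_lt_one₀ hq0.le hq1 (by norm_num)
    have hF := summable_zpow_hexNorm hx0 hx1
    have h := tsum_hexNorm_eq (F := fun k => (q ^ 3) ^ k) hF
    rw [tsum_sixfold (F := fun k => (q ^ 3) ^ k) hF, tsum_zpow_hexNorm hx0 hx1, ← pow_mul,
      zpow_zero] at h
    have hL : (∑' (m : ℕ) (n : ℕ), q ^ (3 * ((m + 1) ^ 2 + (m + 1) * (n + 1) + (n + 1) ^ 2)))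
        = ∑' (m : ℕ) (n : ℕ), (q ^ 3) ^ hexNorm ((m : ℤ) + 1, (n : ℤ) + 1) := by
      refine tsum_congr fun m => tsum_congr fun n => ?_
      rw [pow_mul, ← zpow_natCast]
      rfl
    rw [hL, theta3, theta3, theta2, theta2]
    rw [theta3, theta3, theta2, theta2] at h
    linarith
  · set c : ℝ := 16 * π ^ 2 / (27 * ℓ ^ 2) with hc
    have hc' : 16 * π ^ 2 / (9 * ℓ ^ 2) = 3 * c := by rw [hc]; field_simp; norm_num
    have hc0 : 0 < c := by positivity
    have hx : ∀ k : ℤ, Real.exp (-c * ((3 * k : ℤ) : ℝ) * t) = Real.exp (-(3 * c * t)) ^ k :=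
      fun k => by rw [← Real.rpow_intCast, ← Real.exp_mul]; congr 1; push_cast; ring
    have hF := summable_zpow_hexNorm (Real.exp_pos (-(3 * c * t)))
      (Real.exp_lt_one_iff.2 (by have := mul_pos hc0 ht; linarith))
    simp only [← hx] at hF
    have h := tsum_subtype_eq_tsum_hexRegular fun k => Real.exp (-c * (k : ℝ) * t)
    rw [tsum_sixfold (F := fun k => Real.exp (-c * ((3 * k : ℤ) : ℝ) * t)) hF] at h
    push_cast at h
    rw [h, hc', ← mul_assoc, one_div, inv_mul_cancel₀ (by norm_num : (6 : ℝ) ≠ 0), one_mul]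
    refine tsum_congr fun m => tsum_congr fun n => ?_
    congr 1
    simp only [hexNorm]
    push_cast
    ring
end

section
/- Let ℓ > 0. Then as t → 0⁺, the Dirichlet heat trace of the hemi-equilateral (30-60-90) triangle with hypotenuse of length ℓ satisfies ∑_{m > n ≥ 1} exp(−(16π²/(9ℓ²))(m² + mn + n²) t) = ℓ²√3/(32πt) − ℓ(3 + √3)/(16√(πt)) + 5/12 − (ℓ/8)·√(3/(πt))·e^{−3ℓ²/(16t)} − (3ℓ/(8√(πt)))·e^{−9ℓ²/(16t)} + O(t^{−1} e^{−3ℓ²/(4t)}). -/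
open Real Filter Asymptotics
open scoped Topology

/-- The one-dimensional theta series `∑_{n ∈ ℤ} exp(-c n²)`. -/
noncomputable def thetaSeries (c : ℝ) : ℝ := ∑' n : ℤ, Real.exp (-(c * (n : ℝ) ^ 2))

lemma summable_exp_neg_mul_nat_add_sq {c : ℝ} (hc : 0 < c) (k : ℕ) :
    Summable fun n : ℕ => Real.exp (-(c * ((n : ℝ) + k) ^ 2)) := by
  have hlt : Real.exp (-c) < 1 := by simpa using hc
  refine Summable.of_nonneg_of_le (fun _ => (Real.exp_pos _).le) (fun n => ?_)
    (summable_geometric_of_lt_one (Real.exp_pos _).le hlt)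
  rw [← Real.exp_nat_mul, Real.exp_le_exp]
  have hn : (n : ℝ) ≤ ((n : ℝ) + k) ^ 2 := by
    have h : n ≤ (n + k) ^ 2 :=
      (Nat.le_add_right n k).trans (Nat.le_self_pow two_ne_zero _)
    exact_mod_cast h
  nlinarith

lemma summable_exp_neg_mul_int_sq {c : ℝ} (hc : 0 < c) :
    Summable fun n : ℤ => Real.exp (-(c * (n : ℝ) ^ 2)) := by
  have h := summable_exp_neg_mul_nat_add_sq hc 0
  refine Summable.of_nat_of_neg ?_ ?_ <;> simpa using h

lemma thetaSeries_eq_one_add {c : ℝ} (hc : 0 < c) :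
    thetaSeries c = 1 + 2 * ∑' n : ℕ, Real.exp (-(c * ((n : ℝ) + 1) ^ 2)) := by
  have h0 := summable_exp_neg_mul_nat_add_sq hc 0
  have h1 := summable_exp_neg_mul_nat_add_sq hc 1
  simp only [Nat.cast_zero, add_zero, Nat.cast_one] at h0 h1
  have hneg : ∀ n : ℕ, ((-((n : ℤ) + 1) : ℤ) : ℝ) ^ 2 = ((n : ℝ) + 1) ^ 2 := fun n => by
    push_cast; ring
  rw [thetaSeries, tsum_of_nat_of_neg_add_one (by simpa using h0) (by simpa only [hneg] using h1)]
  simp only [hneg, Int.cast_natCast]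
  rw [h0.tsum_eq_zero_add]
  push_cast
  simp
  ring

/-- Poisson summation (the modular transformation) for the theta series. -/
lemma thetaSeries_eq_sqrt_mul {c : ℝ} (hc : 0 < c) :
    thetaSeries c = √(π / c) * thetaSeries (π ^ 2 / c) := by
  have h := Real.tsum_exp_neg_mul_int_sq (a := c / π) (by positivity)
  rw [← Real.sqrt_eq_rpow, one_div, ← Real.sqrt_inv, inv_div] at h
  have e1 : ∀ n : ℤ, -(c * (n : ℝ) ^ 2) = -π * (c / π) * (n : ℝ) ^ 2 := fun n => by field_simp
  have e2 : ∀ n : ℤ, -(π ^ 2 / c * (n : ℝ) ^ 2) = -π / (c / π) * (n : ℝ) ^ 2 := fun n => by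
    field_simp
  simp only [thetaSeries, e1, e2]
  exact h

/-- The theta series minus its first two terms. -/
lemma abs_thetaSeries_sub_le {d : ℝ} (hd : 0 < d) (h2 : Real.exp (-d) ≤ 1 / 2) :
    |thetaSeries d - (1 + 2 * Real.exp (-d))| ≤ 4 * Real.exp (-d) ^ 4 := by
  set q := Real.exp (-d) with hq
  have hq0 : 0 < q := Real.exp_pos _
  have h1 := summable_exp_neg_mul_nat_add_sq hd 1
  have hs := summable_exp_neg_mul_nat_add_sq hd 2
  simp only [Nat.cast_one, Nat.cast_ofNat] at h1 hs
  have hg := hasSum_geometric_two.mul_left (q ^ 4)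
  have hle : ∑' n : ℕ, Real.exp (-(d * ((n : ℝ) + 2) ^ 2)) ≤ q ^ 4 * 2 := by
    rw [← hg.tsum_eq]
    refine hs.tsum_le_tsum (fun n => ?_) hg.summable
    have hqn : q ^ n ≤ (1 / 2) ^ n := pow_le_pow_left₀ hq0.le h2 n
    refine le_trans ?_ (mul_le_mul_of_nonneg_left hqn (by positivity))
    rw [hq, ← Real.exp_nat_mul, ← Real.exp_nat_mul, ← Real.exp_add, Real.exp_le_exp]
    have : 0 ≤ d * ((n : ℝ) ^ 2 + 3 * n) := by positivity
    push_cast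
    nlinarith
  have hnn : 0 ≤ ∑' n : ℕ, Real.exp (-(d * ((n : ℝ) + 2) ^ 2)) :=
    tsum_nonneg fun _ => (Real.exp_pos _).le
  have hshift : ∑' n : ℕ, Real.exp (-(d * ((n : ℝ) + 1) ^ 2))
      = q + ∑' n : ℕ, Real.exp (-(d * ((n : ℝ) + 2) ^ 2)) := by
    rw [h1.tsum_eq_zero_add]
    push_cast
    simp only [add_assoc, zero_add, one_pow, mul_one, hq]
    norm_num
  rw [thetaSeries_eq_one_add hd, hshift, abs_le]
  constructor <;> nlinarith [pow_pos hq0 4]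

lemma bijective_sumElim_even_odd :
    Function.Bijective (Sum.elim (fun m : ℤ => 2 * m) (fun m : ℤ => 2 * m + 1)) := by
  constructor
  · rintro (a | a) (b | b) h <;> simp at h ⊢ <;> omega
  · intro n
    rcases Int.even_or_odd' n with ⟨k, h | h⟩
    · exact ⟨.inl k, h.symm⟩
    · exact ⟨.inr k, h.symm⟩

lemma hasSum_exp_neg_mul_int_add_half_sq {c : ℝ} (hc : 0 < c) :
    HasSum (fun n : ℤ => Real.exp (-(c * ((n : ℝ) + 1 / 2) ^ 2)))
      (thetaSeries (c / 4) - thetaSeries c) := by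
  have h4 := summable_exp_neg_mul_int_sq (c := c / 4) (by positivity)
  have hodd : Summable fun n : ℤ => Real.exp (-(c * ((n : ℝ) + 1 / 2) ^ 2)) := by
    refine (h4.comp_injective (i := fun m : ℤ => 2 * m + 1) fun a b h => by simpa using h).congr
      fun n => ?_
    simp only [Function.comp_apply]
    push_cast
    ring_nf
  have heven := summable_exp_neg_mul_int_sq hc
  have key : HasSum (fun n : ℤ => Real.exp (-(c / 4 * (n : ℝ) ^ 2)))
      (thetaSeries c + ∑' n : ℤ, Real.exp (-(c * ((n : ℝ) + 1 / 2) ^ 2))) := by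
    rw [← (Equiv.ofBijective _ bijective_sumElim_even_odd).hasSum_iff]
    refine HasSum.sum ?_ ?_
    · refine heven.hasSum.congr_fun fun p => ?_
      simp only [Function.comp_apply, Equiv.ofBijective_apply, Sum.elim_inl]
      push_cast
      ring_nf
    · refine hodd.hasSum.congr_fun fun p => ?_
      simp only [Function.comp_apply, Equiv.ofBijective_apply, Sum.elim_inr]
      push_cast
      ring_nf
  convert hodd.hasSum using 1
  rw [sub_eq_iff_eq_add', ← key.tsum_eq, thetaSeries]

lemma bijective_sumElim_hexagonal_parity :
    Function.Bijective (Sum.elim (fun p : ℤ × ℤ => (p.1 - p.2, 2 * p.2))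
      (fun p : ℤ × ℤ => (p.1 - p.2, 2 * p.2 + 1))) := by
  constructor
  · rintro (⟨a, b⟩ | ⟨a, b⟩) (⟨a', b'⟩ | ⟨a', b'⟩) h <;> simp at h ⊢ <;> omega
  · rintro ⟨m, n⟩
    rcases Int.even_or_odd' n with ⟨k, h | h⟩
    · exact ⟨.inl (m + k, k), by simp [h]⟩
    · exact ⟨.inr (m + k, k), by simp [h]⟩

/-- The theta series of the hexagonal lattice in terms of one-dimensional theta series. -/
lemma hasSum_hexagonal {c : ℝ} (hc : 0 < c) :
    HasSum (fun p : ℤ × ℤ =>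
        Real.exp (-(c * ((p.1 : ℝ) ^ 2 + (p.1 : ℝ) * p.2 + (p.2 : ℝ) ^ 2))))
      (thetaSeries c * thetaSeries (3 * c)
        + (thetaSeries (c / 4) - thetaSeries c)
          * (thetaSeries (3 * c / 4) - thetaSeries (3 * c))) := by
  have h3 : 0 < 3 * c := by positivity
  have hnn : ∀ (f : ℤ → ℝ), 0 ≤ fun n => Real.exp (f n) := fun f n => (Real.exp_pos _).le
  have e1 := summable_exp_neg_mul_int_sq hc
  have e3 := summable_exp_neg_mul_int_sq h3
  have o1 := hasSum_exp_neg_mul_int_add_half_sq hc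
  have o3 := hasSum_exp_neg_mul_int_add_half_sq h3
  rw [← (Equiv.ofBijective _ bijective_sumElim_hexagonal_parity).hasSum_iff]
  refine HasSum.sum ?_ ?_
  · refine (e1.hasSum.mul e3.hasSum (e1.mul_of_nonneg e3 (hnn _) (hnn _))).congr_fun
      fun p => ?_
    rw [← Real.exp_add]
    simp only [Function.comp_apply, Equiv.ofBijective_apply, Sum.elim_inl]
    push_cast
    ring_nf
  · refine (o1.mul o3 (o1.summable.mul_of_nonneg o3.summable (hnn _) (hnn _))).congr_fun
      fun p => ?_
    rw [← Real.exp_add]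
    simp only [Function.comp_apply, Equiv.ofBijective_apply, Sum.elim_inr]
    push_cast
    ring_nf

/-- The six rotations by multiples of `π / 3` of the half-open sector `m ≥ 1, n ≥ 0`. -/
def hexagonalSector (i : Fin 6) (p : ℕ × ℕ) : ℤ × ℤ :=
  match i with
  | 0 => (p.1 + 1, p.2)
  | 1 => (-p.2, p.1 + 1 + p.2)
  | 2 => (-(p.1 + 1 + p.2), p.1 + 1)
  | 3 => (-(p.1 + 1), -p.2)
  | 4 => (p.2, -(p.1 + 1 + p.2))
  | 5 => (p.1 + 1 + p.2, -(p.1 + 1))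

lemma bijective_hexagonalSector :
    Function.Bijective (Sum.elim (fun _ : Unit => ((0, 0) : ℤ × ℤ))
      (fun x : Fin 6 × (ℕ × ℕ) => hexagonalSector x.1 x.2)) := by
  constructor
  · rintro (⟨⟩ | ⟨i, a, b⟩) (⟨⟩ | ⟨j, a', b'⟩) h
    · rfl
    · fin_cases j <;> simp [hexagonalSector] at h <;> omega
    · fin_cases i <;> simp [hexagonalSector] at h <;> omega
    · fin_cases i <;> fin_cases j <;> simp [hexagonalSector] at h ⊢ <;> omega
  · rintro ⟨m, n⟩
    by_cases h0 : m = 0 ∧ n = 0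
    · exact ⟨.inl (), by simp [h0]⟩
    have h : (1 ≤ m ∧ 0 ≤ n) ∨ (m ≤ 0 ∧ 1 ≤ m + n) ∨ (m + n ≤ 0 ∧ 1 ≤ n) ∨
        (m ≤ -1 ∧ n ≤ 0) ∨ (0 ≤ m ∧ m + n ≤ -1) ∨ (0 ≤ m + n ∧ n ≤ -1) := by omega
    rcases h with h | h | h | h | h | h
    · exact ⟨.inr (0, (m - 1).toNat, n.toNat), by simp [hexagonalSector]; omega⟩
    · exact ⟨.inr (1, (m + n - 1).toNat, (-m).toNat), by simp [hexagonalSector]; omega⟩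
    · exact ⟨.inr (2, (n - 1).toNat, (-(m + n)).toNat), by simp [hexagonalSector]; omega⟩
    · exact ⟨.inr (3, (-m - 1).toNat, (-n).toNat), by simp [hexagonalSector]; omega⟩
    · exact ⟨.inr (4, (-(m + n) - 1).toNat, m.toNat), by simp [hexagonalSector]; omega⟩
    · exact ⟨.inr (5, (-n - 1).toNat, (m + n).toNat), by simp [hexagonalSector]; omega⟩

lemma hexagonalSector_normForm (i : Fin 6) (p : ℕ × ℕ) :
    ((hexagonalSector i p).1 : ℝ) ^ 2 + ((hexagonalSector i p).1 : ℝ) * (hexagonalSector i p).2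
        + ((hexagonalSector i p).2 : ℝ) ^ 2
      = ((p.1 : ℝ) + 1) ^ 2 + ((p.1 : ℝ) + 1) * p.2 + (p.2 : ℝ) ^ 2 := by
  fin_cases i <;> simp [hexagonalSector] <;> ring

lemma bijective_sector_decomposition :
    Function.Bijective (Sum.elim (fun n : ℕ => ((n, 0) : ℕ × ℕ))
      (Sum.elim (fun n : ℕ => (n, n + 1))
        (Sum.elim (fun p : ℕ × ℕ => (p.2 + p.1 + 1, p.2 + 1))
          (fun p : ℕ × ℕ => (p.2, p.2 + p.1 + 2))))) := by
  constructor
  · rintro (a | a | ⟨a, b⟩ | ⟨a, b⟩) (a' | a' | ⟨a', b'⟩ | ⟨a', b'⟩) h <;> simp at h ⊢ <;> omega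
  · rintro ⟨m, n⟩
    have h : n = 0 ∨ n = m + 1 ∨ (1 ≤ n ∧ n ≤ m) ∨ m + 2 ≤ n := by omega
    rcases h with h | h | h | h
    · exact ⟨.inl m, by simp [h]⟩
    · exact ⟨.inr (.inl m), by simp [h]⟩
    · exact ⟨.inr (.inr (.inl (m - n, n - 1))), by simp; omega⟩
    · exact ⟨.inr (.inr (.inr (n - m - 2, m))), by simp; omega⟩

lemma bijective_chamber : Function.Bijective
    (fun p : ℕ × ℕ => (⟨(p.2 + p.1 + 2, p.2 + 1), by simp⟩ :
      {p : ℕ × ℕ // 1 ≤ p.2 ∧ p.2 < p.1})) := by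
  constructor
  · rintro ⟨a, b⟩ ⟨a', b'⟩ h
    simp at h ⊢
    omega
  · rintro ⟨⟨m, n⟩, h1, h2⟩
    simp only at h1 h2
    exact ⟨(m - n - 1, n - 1), by simp; omega⟩

/-- Counting the points of the hexagonal lattice by chambers of its point group. -/
lemma tsum_hexagonal_eq_chamber {c : ℝ} (hc : 0 < c) :
    ∑' p : ℤ × ℤ, Real.exp (-(c * ((p.1 : ℝ) ^ 2 + (p.1 : ℝ) * p.2 + (p.2 : ℝ) ^ 2)))
      = 12 * (∑' p : {p : ℕ × ℕ // 1 ≤ p.2 ∧ p.2 < p.1},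
          Real.exp (-(c * ((p.1.1 : ℝ) ^ 2 + (p.1.1 : ℝ) * p.1.2 + (p.1.2 : ℝ) ^ 2))))
        + 3 * thetaSeries c + 3 * thetaSeries (3 * c) - 5 := by
  have hsum := (hasSum_hexagonal hc).summable
  have hs1 := (Equiv.ofBijective _ bijective_hexagonalSector).summable_iff.mpr hsum
  have hsec : Summable fun x : Fin 6 × (ℕ × ℕ) => Real.exp (-(c *
      (((x.2.1 : ℝ) + 1) ^ 2 + ((x.2.1 : ℝ) + 1) * x.2.2 + (x.2.2 : ℝ) ^ 2))) := by
    refine (hs1.comp_injective Sum.inr_injective).congr fun x => ?_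
    simp [hexagonalSector_normForm]
  have hsec0 : Summable fun p : ℕ × ℕ => Real.exp (-(c *
      (((p.1 : ℝ) + 1) ^ 2 + ((p.1 : ℝ) + 1) * p.2 + (p.2 : ℝ) ^ 2))) :=
    hsec.comp_injective (i := fun p => (0, p)) (Prod.mk_right_injective 0)
  have hs2 := (Equiv.ofBijective _ bijective_sector_decomposition).summable_iff.mpr hsec0
  have hT : Summable fun p : ℕ × ℕ => Real.exp (-(c * (((p.2 : ℝ) + p.1 + 2) ^ 2
      + ((p.2 : ℝ) + p.1 + 2) * (p.2 + 1) + ((p.2 : ℝ) + 1) ^ 2))) := by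
    refine (hs2.comp_injective
      (Sum.inr_injective.comp (Sum.inr_injective.comp Sum.inl_injective))).congr fun p => ?_
    simp only [Function.comp_apply, Equiv.ofBijective_apply, Sum.elim_inl, Sum.elim_inr]
    push_cast
    ring_nf
  have A : ∑' p : ℤ × ℤ, Real.exp (-(c * ((p.1 : ℝ) ^ 2 + (p.1 : ℝ) * p.2 + (p.2 : ℝ) ^ 2)))
      = 1 + 6 * ∑' p : ℕ × ℕ, Real.exp (-(c *
      (((p.1 : ℝ) + 1) ^ 2 + ((p.1 : ℝ) + 1) * p.2 + (p.2 : ℝ) ^ 2))) := by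
    refine HasSum.tsum_eq ?_
    rw [← (Equiv.ofBijective _ bijective_hexagonalSector).hasSum_iff]
    refine HasSum.sum ?_ ?_
    · simp [Function.comp_def]
    · convert hsec.hasSum using 1
      · ext x
        simp [hexagonalSector_normForm]
      · rw [hsec.tsum_prod]
        simp
  have B : ∑' p : ℕ × ℕ, Real.exp (-(c *
      (((p.1 : ℝ) + 1) ^ 2 + ((p.1 : ℝ) + 1) * p.2 + (p.2 : ℝ) ^ 2)))
      = ∑' n : ℕ, Real.exp (-(c * ((n : ℝ) + 1) ^ 2))
        + (∑' n : ℕ, Real.exp (-(3 * c * ((n : ℝ) + 1) ^ 2))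
        + (∑' p : ℕ × ℕ, Real.exp (-(c * (((p.2 : ℝ) + p.1 + 2) ^ 2
            + ((p.2 : ℝ) + p.1 + 2) * (p.2 + 1) + ((p.2 : ℝ) + 1) ^ 2)))
          + ∑' p : ℕ × ℕ, Real.exp (-(c * (((p.2 : ℝ) + p.1 + 2) ^ 2
            + ((p.2 : ℝ) + p.1 + 2) * (p.2 + 1) + ((p.2 : ℝ) + 1) ^ 2))))) := by
    have h1 := summable_exp_neg_mul_nat_add_sq hc 1
    have h3 := summable_exp_neg_mul_nat_add_sq (c := 3 * c) (by positivity) 1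
    simp only [Nat.cast_one] at h1 h3
    refine HasSum.tsum_eq ?_
    rw [← (Equiv.ofBijective _ bijective_sector_decomposition).hasSum_iff]
    refine HasSum.sum ?_ (HasSum.sum ?_ (HasSum.sum ?_ ?_))
    · refine h1.hasSum.congr_fun fun p => ?_
      simp only [Function.comp_apply, Equiv.ofBijective_apply, Sum.elim_inl]
      push_cast
      ring_nf
    · refine h3.hasSum.congr_fun fun p => ?_
      simp only [Function.comp_apply, Equiv.ofBijective_apply, Sum.elim_inl, Sum.elim_inr]
      push_cast
      ring_nf
    · refine hT.hasSum.congr_fun fun p => ?_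
      simp only [Function.comp_apply, Equiv.ofBijective_apply, Sum.elim_inl, Sum.elim_inr]
      push_cast
      ring_nf
    · refine hT.hasSum.congr_fun fun p => ?_
      simp only [Function.comp_apply, Equiv.ofBijective_apply, Sum.elim_inr]
      push_cast
      ring_nf
  have C : ∑' p : {p : ℕ × ℕ // 1 ≤ p.2 ∧ p.2 < p.1},
        Real.exp (-(c * ((p.1.1 : ℝ) ^ 2 + (p.1.1 : ℝ) * p.1.2 + (p.1.2 : ℝ) ^ 2)))
      = ∑' p : ℕ × ℕ, Real.exp (-(c * (((p.2 : ℝ) + p.1 + 2) ^ 2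
            + ((p.2 : ℝ) + p.1 + 2) * (p.2 + 1) + ((p.2 : ℝ) + 1) ^ 2))) := by
    rw [← (Equiv.ofBijective _ bijective_chamber).tsum_eq]
    simp
  rw [A, B, C, thetaSeries_eq_one_add hc, thetaSeries_eq_one_add (c := 3 * c) (by positivity)]
  ring

/-- Cancellation in the dual side of the hexagonal theta series. -/
lemma abs_theta_product_sub_le {q E1 E3 E4 E12 : ℝ} (hq0 : 0 ≤ q) (hq : q ≤ 1 / 2)
    (h1 : |E1 - (1 + 2 * q)| ≤ 4 * q ^ 4) (h3 : |E3 - (1 + 2 * q ^ 3)| ≤ 4 * (q ^ 3) ^ 4)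
    (h4 : |E4 - (1 + 2 * q ^ 4)| ≤ 4 * (q ^ 4) ^ 4)
    (h12 : |E12 - (1 + 2 * q ^ 12)| ≤ 4 * (q ^ 12) ^ 4) :
    |E3 * E1 + (2 * E12 - E3) * (2 * E4 - E1) - 2| ≤ 240 * q ^ 4 := by
  have hpow : ∀ k, 4 ≤ k → q ^ k ≤ q ^ 4 := fun k hk =>
    pow_le_pow_of_le_one hq0 (by linarith) hk
  have p12 := hpow 12 (by norm_num)
  have p16 := hpow 16 (by norm_num)
  have p48 := hpow 48 (by norm_num)
  have q4 : q ^ 4 ≤ 1 / 16 := (pow_le_pow_left₀ hq0 hq 4).trans (by norm_num)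
  have q3 : q ^ 3 ≤ 1 / 8 := (pow_le_pow_left₀ hq0 hq 3).trans (by norm_num)
  have q12 : 0 ≤ q ^ 12 := by positivity
  rw [← pow_mul] at h3 h4 h12
  norm_num at h3 h4 h12
  obtain ⟨a, ha⟩ : ∃ a, a = E1 - (1 + 2 * q) := ⟨_, rfl⟩
  obtain ⟨b, hb⟩ : ∃ b, b = E3 - (1 + 2 * q ^ 3) := ⟨_, rfl⟩
  obtain ⟨f, hf⟩ : ∃ f, f = 2 * E4 - E1 - (1 - 2 * q) := ⟨_, rfl⟩
  obtain ⟨k, hk⟩ : ∃ k, k = 2 * E12 - E3 - (1 - 2 * q ^ 3) := ⟨_, rfl⟩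
  have ba : |a| ≤ 4 * q ^ 4 := ha ▸ h1
  have bb : |b| ≤ 4 * q ^ 4 := hb ▸ h3.trans (by linarith)
  have bf : |f| ≤ 16 * q ^ 4 := by
    rw [abs_le] at *
    constructor <;> linarith
  have bk : |k| ≤ 16 * q ^ 4 := by
    rw [abs_le] at *
    constructor <;> linarith
  have m1 : |2 * q ^ 3 * (a - f)| ≤ 1 * (20 * q ^ 4) := by
    rw [abs_mul]
    refine mul_le_mul ?_ ((abs_sub _ _).trans (by linarith)) (abs_nonneg _) zero_le_one
    rw [abs_of_nonneg (by positivity)]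
    linarith
  have m2 : |b * (1 + 2 * q + a)| ≤ 4 * q ^ 4 * 3 := by
    rw [abs_mul]
    refine mul_le_mul bb ?_ (abs_nonneg _) (by positivity)
    rw [abs_le] at *
    constructor <;> linarith
  have m3 : |k * (1 - 2 * q + f)| ≤ 16 * q ^ 4 * 3 := by
    rw [abs_mul]
    refine mul_le_mul bk ?_ (abs_nonneg _) (by positivity)
    rw [abs_le] at *
    constructor <;> linarith
  have hX : E3 * E1 + (2 * E12 - E3) * (2 * E4 - E1) - 2
      = 8 * q ^ 4 + a + f + 2 * q ^ 3 * (a - f) + b * (1 + 2 * q + a) + k * (1 - 2 * q + f) := by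
    rw [ha, hb, hf, hk]
    ring
  rw [hX]
  rw [abs_le] at *
  constructor <;> linarith

/-- The chamber sum with its Poisson-dual main terms removed, where `q = exp(-π²/(3c))`. -/
lemma abs_chamber_sub_le {c : ℝ} (hc : 0 < c) (hq : Real.exp (-(π ^ 2 / (3 * c))) ≤ 1 / 2) :
    |(∑' p : {p : ℕ × ℕ // 1 ≤ p.2 ∧ p.2 < p.1},
          Real.exp (-(c * ((p.1.1 : ℝ) ^ 2 + (p.1.1 : ℝ) * p.1.2 + (p.1.2 : ℝ) ^ 2))))
        - (√(π / c) * √(π / (3 * c)) / 6 + 5 / 12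
          - √(π / c) / 4 * (1 + 2 * Real.exp (-(π ^ 2 / c)))
          - √(π / (3 * c)) / 4 * (1 + 2 * Real.exp (-(π ^ 2 / (3 * c)))))|
      ≤ (20 * √(π / c) * √(π / (3 * c)) + √(π / c) + √(π / (3 * c)))
        * Real.exp (-(π ^ 2 / (3 * c))) ^ 4 := by
  have h3c : 0 < 3 * c := by positivity
  have hsum := tsum_hexagonal_eq_chamber hc
  rw [(hasSum_hexagonal hc).tsum_eq] at hsum
  have hP : ∀ a : ℝ, 0 < a →
      thetaSeries (a / 4) = 2 * √(π / a) * thetaSeries (4 * (π ^ 2 / a)) := by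
    intro a ha
    rw [thetaSeries_eq_sqrt_mul (c := a / 4) (by positivity),
      show π / (a / 4) = 2 ^ 2 * (π / a) by field_simp; norm_num,
      Real.sqrt_mul (by norm_num), Real.sqrt_sq (by norm_num)]
    congr 2
    field_simp
  rw [hP c hc, hP (3 * c) h3c, thetaSeries_eq_sqrt_mul hc, thetaSeries_eq_sqrt_mul h3c] at hsum
  set T := ∑' p : {p : ℕ × ℕ // 1 ≤ p.2 ∧ p.2 < p.1},
          Real.exp (-(c * ((p.1.1 : ℝ) ^ 2 + (p.1.1 : ℝ) * p.1.2 + (p.1.2 : ℝ) ^ 2)))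
  set s := √(π / c)
  set r := √(π / (3 * c))
  have hs : 0 ≤ s := Real.sqrt_nonneg _
  have hr : 0 ≤ r := Real.sqrt_nonneg _
  have hd1 : π ^ 2 / c = 3 * (π ^ 2 / (3 * c)) := by field_simp
  rw [hd1] at hsum ⊢
  have hd : 0 < π ^ 2 / (3 * c) := by positivity
  set d := π ^ 2 / (3 * c)
  set q := Real.exp (-d) with hqdef
  have hq0 : 0 < q := Real.exp_pos _
  have hexp : ∀ k : ℕ, Real.exp (-(k * d)) = q ^ k := fun k => by
    rw [hqdef, ← Real.exp_nat_mul]; ring_nf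
  have he3 : Real.exp (-(3 * d)) = q ^ 3 := by simpa using hexp 3
  have he4 : Real.exp (-(4 * d)) = q ^ 4 := by simpa using hexp 4
  have he12 : Real.exp (-(4 * (3 * d))) = q ^ 12 := by
    rw [← hexp 12]; push_cast; ring_nf
  have hpow : ∀ k : ℕ, k ≠ 0 → q ^ k ≤ q := fun k hk =>
    pow_le_of_le_one hq0.le (by linarith) hk
  have b1 := abs_thetaSeries_sub_le hd hq
  have b3 := abs_thetaSeries_sub_le (d := 3 * d) (by positivity)
    (by rw [he3]; exact (hpow 3 (by norm_num)).trans hq)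
  have b4 := abs_thetaSeries_sub_le (d := 4 * d) (by positivity)
    (by rw [he4]; exact (hpow 4 (by norm_num)).trans hq)
  have b12 := abs_thetaSeries_sub_le (d := 4 * (3 * d)) (by positivity)
    (by rw [he12]; exact (hpow 12 (by norm_num)).trans hq)
  rw [he3] at b3 ⊢
  rw [he4] at b4
  rw [he12] at b12
  generalize thetaSeries d = E1, thetaSeries (3 * d) = E3, thetaSeries (4 * d) = E4,
    thetaSeries (4 * (3 * d)) = E12 at *
  have hsr : 0 ≤ s * r := mul_nonneg hs hr
  have hX := abs_theta_product_sub_le hq0.le hq b1 b3 b4 b12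
  have hT : T - (s * r / 6 + 5 / 12 - s / 4 * (1 + 2 * q ^ 3) - r / 4 * (1 + 2 * q))
      = s * r / 12 * (E3 * E1 + (2 * E12 - E3) * (2 * E4 - E1) - 2)
        - s / 4 * (E3 - (1 + 2 * q ^ 3)) - r / 4 * (E1 - (1 + 2 * q)) := by
    linear_combination -hsum / 12
  have hq12 : (q ^ 3) ^ 4 ≤ q ^ 4 := by
    rw [← pow_mul]
    exact pow_le_pow_of_le_one hq0.le (by linarith) (by norm_num)
  have hY : |s * r / 12 * (E3 * E1 + (2 * E12 - E3) * (2 * E4 - E1) - 2)|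
      ≤ s * r / 12 * (240 * q ^ 4) := by
    rw [abs_mul, abs_of_nonneg (by positivity)]
    gcongr
  have hZ : |s / 4 * (E3 - (1 + 2 * q ^ 3))| ≤ s / 4 * (4 * q ^ 4) := by
    rw [abs_mul, abs_of_nonneg (by positivity)]
    gcongr
    linarith
  have hW : |r / 4 * (E1 - (1 + 2 * q))| ≤ r / 4 * (4 * q ^ 4) := by
    rw [abs_mul, abs_of_nonneg (by positivity)]
    gcongr
  rw [hT]
  refine (abs_sub _ _).trans ((add_le_add ((abs_sub _ _).trans (add_le_add hY hZ)) hW).trans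
    (le_of_eq ?_))
  ring

/-- **Sharp short-time asymptotics of the Dirichlet heat trace of the hemi-equilateral
(30-60-90) triangle** with hypotenuse of length `ℓ`: as `t → 0⁺`,
`∑_{m > n ≥ 1} exp(−(16π²/(9ℓ²))(m² + mn + n²)t)
  = ℓ²√3/(32πt) − ℓ(3+√3)/(16√(πt)) + 5/12 − (ℓ/8)√(3/(πt))e^{−3ℓ²/(16t)}
    − (3ℓ/(8√(πt)))e^{−9ℓ²/(16t)} + O(t⁻¹ e^{−3ℓ²/(4t)})`. -/
theorem hemiEquilateral_dirichlet_heat_trace_asymptotics (ℓ : ℝ) (hℓ : 0 < ℓ) :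
    (fun t : ℝ =>
      (∑' p : {p : ℕ × ℕ // 1 ≤ p.2 ∧ p.2 < p.1},
          Real.exp (-(16 * π ^ 2 / (9 * ℓ ^ 2))
            * ((p.1.1 : ℝ) ^ 2 + (p.1.1 : ℝ) * (p.1.2 : ℝ) + (p.1.2 : ℝ) ^ 2) * t))
        - (ℓ ^ 2 * Real.sqrt 3 / (32 * π * t) - ℓ * (3 + Real.sqrt 3) / (16 * Real.sqrt (π * t))
            + 5 / 12
            - ℓ / 8 * Real.sqrt (3 / (π * t)) * Real.exp (-(3 * ℓ ^ 2) / (16 * t))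
            - 3 * ℓ / (8 * Real.sqrt (π * t)) * Real.exp (-(9 * ℓ ^ 2) / (16 * t))))
      =O[𝓝[>] (0 : ℝ)]
    (fun t : ℝ => t⁻¹ * Real.exp (-(3 * ℓ ^ 2) / (4 * t))) := by
  set κ : ℝ := 16 * π ^ 2 / (9 * ℓ ^ 2) with hκ
  have hκ0 : 0 < κ := by positivity
  have hexp0 : Tendsto (fun t : ℝ => Real.exp (-(3 * ℓ ^ 2) / (16 * t))) (𝓝[>] 0) (𝓝 0) := by
    refine Real.tendsto_exp_atBot.comp ?_
    have h : Tendsto (fun t : ℝ => (-(3 * ℓ ^ 2) / 16) * t⁻¹) (𝓝[>] 0) atBot :=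
      tendsto_inv_nhdsGT_zero.const_mul_atTop_of_neg (by
        have : 0 < ℓ ^ 2 := by positivity
        linarith)
    refine h.congr fun t => ?_
    rw [div_mul_eq_div_div, div_eq_mul_inv _ t]
  refine IsBigO.of_bound (4 * ℓ ^ 2 + 2 * ℓ) ?_
  have hlt1 : ∀ᶠ t : ℝ in 𝓝[>] 0, t < 1 := nhdsWithin_le_nhds (gt_mem_nhds zero_lt_one)
  filter_upwards [self_mem_nhdsWithin, hlt1, hexp0.eventually (ge_mem_nhds one_half_pos)]
    with t ht ht1 hq
  have ht0 : 0 < t := ht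
  have hc : 0 < κ * t := by positivity
  have hd3 : -(π ^ 2 / (3 * (κ * t))) = -(3 * ℓ ^ 2) / (16 * t) := by
    rw [hκ]
    field_simp
    norm_num
  have hd1 : -(π ^ 2 / (κ * t)) = -(9 * ℓ ^ 2) / (16 * t) := by
    rw [hκ]
    field_simp
  have hs : √(π / (κ * t)) = 3 * ℓ / (4 * √(π * t)) := by
    rw [show π / (κ * t) = (3 * ℓ / 4) ^ 2 / (π * t) by rw [hκ]; field_simp; norm_num,
      Real.sqrt_div (by positivity), Real.sqrt_sq (by positivity)]
    field_simp
  have hr : √(π / (3 * (κ * t))) = √3 * ℓ / (4 * √(π * t)) := by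
    rw [show π / (3 * (κ * t)) = 3 * (ℓ / 4) ^ 2 / (π * t) by rw [hκ]; field_simp; norm_num,
      Real.sqrt_div (by positivity), Real.sqrt_mul (by norm_num), Real.sqrt_sq (by positivity)]
    field_simp
  have hq4 : Real.exp (-(3 * ℓ ^ 2) / (16 * t)) ^ 4 = Real.exp (-(3 * ℓ ^ 2) / (4 * t)) := by
    rw [← Real.exp_nat_mul]
    congr 1
    push_cast
    field_simp
    norm_num
  have main := abs_chamber_sub_le hc (by rw [hd3]; exact hq)
  rw [hd1, hd3, hs, hr, hq4] at main
  have hw2 : √(π * t) ^ 2 = π * t := Real.sq_sqrt (by positivity)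
  have hterm : ∀ p : ℕ × ℕ, -κ * ((p.1 : ℝ) ^ 2 + (p.1 : ℝ) * p.2 + (p.2 : ℝ) ^ 2) * t
      = -(κ * t * ((p.1 : ℝ) ^ 2 + (p.1 : ℝ) * p.2 + (p.2 : ℝ) ^ 2)) := fun p => by ring
  simp only [hterm]
  rw [Real.norm_eq_abs, Real.norm_of_nonneg (by positivity), Real.sqrt_div (by norm_num)]
  have htw : t ≤ √(π * t) := Real.le_sqrt_of_sq_le (by nlinarith [Real.pi_gt_three])
  have hwt : (√(π * t))⁻¹ ≤ t⁻¹ := inv_anti₀ ht0 htw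
  have h3le : √3 ≤ (2 : ℝ) := Real.sqrt_le_iff.mpr ⟨by norm_num, by norm_num⟩
  have hprod : 3 * ℓ / (4 * √(π * t)) * (√3 * ℓ / (4 * √(π * t)))
      = 3 * √3 * ℓ ^ 2 / (16 * (π * t)) := by
    rw [div_mul_div_comm, show 4 * √(π * t) * (4 * √(π * t)) = 16 * √(π * t) ^ 2 by ring, hw2]
    congr 1
    ring
  have hprod_le : 20 * (3 * √3 * ℓ ^ 2 / (16 * (π * t))) ≤ 4 * ℓ ^ 2 * t⁻¹ := by
    rw [← div_eq_mul_inv, ← mul_div_assoc, div_le_div_iff₀ (by positivity) ht0]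
    have : 0 < ℓ ^ 2 * t := by positivity
    nlinarith [Real.pi_gt_three, mul_le_mul_of_nonneg_left h3le this.le,
      mul_le_mul_of_nonneg_left Real.pi_gt_three.le this.le]
  have hsum_le : 3 * ℓ / (4 * √(π * t)) + √3 * ℓ / (4 * √(π * t)) ≤ 2 * ℓ * t⁻¹ := by
    calc 3 * ℓ / (4 * √(π * t)) + √3 * ℓ / (4 * √(π * t))
        = (3 + √3) / 4 * ℓ * (√(π * t))⁻¹ := by field_simp
      _ ≤ 2 * ℓ * t⁻¹ := by gcongr; linarith
  rw [mul_assoc 20, hprod] at main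
  refine le_trans (le_of_eq ?_) (main.trans ?_)
  · congr 2
    field_simp
    ring
  · rw [← mul_assoc _ t⁻¹]
    exact mul_le_mul_of_nonneg_right (by linarith) (Real.exp_pos _).le
end

section
/- Let n ≥ 3 and let γ₁, …, γₙ be positive real numbers with ∑_{i=1}^n γᵢ = π(n − 2). Then ∑_{i=1}^n (π² − γᵢ²)/(24π·γᵢ) ≥ 1/6 + 1/(6(n − 2)); in particular this sum is strictly greater than 1/6. -/
open Real
open scoped BigOperators

/-- Tangent line bound, with equality at `x = π / m`. -/
theorem tangent_line_le_angle_term (m : ℝ) {x : ℝ} (hx : 0 < x) :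
    2 * m / 24 - (m ^ 2 + 1) / (24 * π) * x ≤ (π ^ 2 - x ^ 2) / (24 * π * x) := by
  have hπ := pi_pos
  have key : (π ^ 2 - x ^ 2) / (24 * π * x) - (2 * m / 24 - (m ^ 2 + 1) / (24 * π) * x)
      = (π - m * x) ^ 2 / (24 * π * x) := by
    field_simp
    ring
  have : 0 ≤ (π - m * x) ^ 2 / (24 * π * x) := by positivity
  linarith

/-- **Lower bound for the angle contribution to the heat trace of a convex polygon.**
If `n ≥ 3` and `γ₁, …, γₙ > 0` satisfy `∑ γᵢ = π(n − 2)`, then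
`∑ᵢ (π² − γᵢ²)/(24πγᵢ) ≥ 1/6 + 1/(6(n−2))`; in particular it is strictly greater
than `1/6`. -/
theorem polygon_angle_coefficient_lower_bound
    (n : ℕ) (hn : 3 ≤ n) (γ : Fin n → ℝ) (hγ : ∀ i, 0 < γ i)
    (hsum : ∑ i, γ i = π * ((n : ℝ) - 2)) :
    1 / 6 + 1 / (6 * ((n : ℝ) - 2)) ≤ ∑ i, (π ^ 2 - γ i ^ 2) / (24 * π * γ i)
      ∧ 1 / 6 < ∑ i, (π ^ 2 - γ i ^ 2) / (24 * π * γ i) := by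
  have hn' : (3 : ℝ) ≤ n := by exact_mod_cast hn
  have hn2 : 0 < (n : ℝ) - 2 := by linarith
  have hπ := pi_pos
  have bound : 1 / 6 + 1 / (6 * ((n : ℝ) - 2)) ≤ ∑ i, (π ^ 2 - γ i ^ 2) / (24 * π * γ i) := by
    refine le_trans (le_of_eq ?_)
      (Finset.sum_le_sum fun i _ => tangent_line_le_angle_term (n / ((n : ℝ) - 2)) (hγ i))
    rw [Finset.sum_sub_distrib, ← Finset.mul_sum, hsum, Finset.sum_const, Finset.card_univ,
      Fintype.card_fin, nsmul_eq_mul]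
    field_simp
    ring
  have : 0 < 1 / (6 * ((n : ℝ) - 2)) := by positivity
  exact ⟨bound, by linarith⟩
end
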